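/- arXiv:1308.2691 — 3 statements merged into one kernel-verified Lean document; each statement's English description precedes it below -/
import Mathlib

section
/- In any group G, the law [[x,y],[x,z]] = 1 (for all x, y, z ∈ G) holds if and only if the law [[x,y],[y,z]] = 1 (for all x, y, z ∈ G) holds. -/
/-- The commutator `[x,y] = x⁻¹y⁻¹xy` as used in the paper. -/
def pcomm {G : Type*} [Group G] (x y : G) : G := x⁻¹ * y⁻¹ * x * y

theorem pcomm_eq_one_iff_commute {G : Type*} [Group G] (a b : G) :
    pcomm a b = 1 ↔ Commute a b := by
  have e : pcomm a b = (b * a)⁻¹ * (a * b) := by simp [pcomm, mul_assoc]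
  rw [e, inv_mul_eq_one]
  exact eq_comm

theorem pcomm_inv_swap {G : Type*} [Group G] (a b : G) :
    (pcomm a b)⁻¹ = pcomm b a := by
  simp [pcomm, mul_assoc]

theorem stmt_2 {G : Type*} [Group G] :
    (∀ x y z : G, pcomm (pcomm x y) (pcomm x z) = 1) ↔
    (∀ x y z : G, pcomm (pcomm x y) (pcomm y z) = 1) := by
  simp only [pcomm_eq_one_iff_commute]
  constructor
  · intro h x y z
    rw [← pcomm_inv_swap y x]
    exact (h y x z).inv_left
  · intro h x y z
    rw [← pcomm_inv_swap y x]
    exact (h y x z).inv_left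
end

section
/- Let G be a group with operations x * y = [x,y] and x • y = [y,x]. Then (G, *, •) is a proper double magma (i.e., the interchange law (w * x) • (y * z) = (w • y) * (x • z) holds for all w, x, y, z ∈ G and the two operations are distinct) if and only if G satisfies the 3-metabelian law [[x,y],[x,z]] = 1 for all x, y, z ∈ G, satisfies the law [[w,x],[y,z]]² = 1 for all w, x, y, z ∈ G, and there exist x, y ∈ G with [x,y]² ≠ 1. -/
/-- The operation `x * y = [x,y]`. -/
def cstar {G : Type*} [Group G] (x y : G) : G := pcomm x y

/-- The operation `x • y = [y,x]`. -/
def cbull {G : Type*} [Group G] (x y : G) : G := pcomm y x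

theorem aux_inv {G : Type*} [Group G] (x y : G) : (pcomm x y)⁻¹ = pcomm y x := by
  simp only [pcomm]; group

theorem aux_comm {G : Type*} [Group G] (x y : G) : pcomm x y = 1 ↔ Commute x y := by
  unfold pcomm Commute SemiconjBy
  constructor
  · intro h
    have : y * x * (x⁻¹ * y⁻¹ * x * y) = y * x := by rw [h, mul_one]
    rw [← this]; group
  · intro h
    rw [mul_assoc, h]; group

theorem aux_mul {G : Type*} [Group G] (u s v : G) (h : Commute u s) :
    pcomm u (s * v) = pcomm u v := by
  have h' : s⁻¹ * u * s = u := by rw [mul_assoc, h.eq]; group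
  calc pcomm u (s * v) = u⁻¹ * v⁻¹ * (s⁻¹ * u * s) * v := by unfold pcomm; group
    _ = _ := by rw [h']; rfl

theorem aux_four {G : Type*} [Group G] (a b c d : G) (hac : Commute a c) (hbd : Commute b d)
    (hab : Commute a b) (hcd : Commute c d) (h : Commute (a * b) (c * d)) :
    pcomm b c = pcomm d⁻¹ a⁻¹ := by
  have h1 : b * c * (a * d) = c * b * (d * a) := by
    calc b * c * (a * d) = b * (c * a) * d := by group
      _ = (b * a) * (c * d) := by rw [← hac.eq]; group
      _ = (c * d) * (a * b) := by rw [← hab.eq, h.eq]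
      _ = c * (d * b) * a := by rw [hab.eq]; group
      _ = _ := by rw [← hbd.eq]; group
  calc pcomm b c = (c * b)⁻¹ * (b * c * (a * d)) * (a * d)⁻¹ := by unfold pcomm; group
    _ = _ := by rw [h1]; unfold pcomm; group

theorem aux_cyc {G : Type*} [Group G]
    (L : ∀ x y z : G, Commute (pcomm x y) (pcomm x z)) (w y x z : G) :
    pcomm (pcomm w y) (pcomm x z) = pcomm (pcomm z w) (pcomm y x) := by
  have key : ∀ v : G, w⁻¹ * v * w = pcomm w v⁻¹ * v := by intro v; unfold pcomm; group
  have R : ∀ p q r : G, Commute (pcomm p q) (pcomm r q) := by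
    intro p q r
    rw [← aux_inv q p, ← aux_inv q r]
    exact (L q p r).inv_inv
  have h := aux_four (w⁻¹ * pcomm x y * w) (pcomm w y) (w⁻¹ * pcomm x z * w) (pcomm w z)
    (by
      have := (L x y z).map (MulAut.conj w⁻¹)
      simpa [MulAut.conj_apply] using this)
    (L w y z)
    (by rw [key]; exact Commute.mul_left (L _ _ _) (R _ _ _))
    (by rw [key]; exact Commute.mul_left (L _ _ _) (R _ _ _))
    (by
      have := L (x * w) y z
      have e : ∀ t, pcomm (x * w) t = w⁻¹ * pcomm x t * w * pcomm w t := by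
        intro t; unfold pcomm; group
      rwa [e, e] at this)
  have e : (w⁻¹ * pcomm x y * w)⁻¹ = w⁻¹ * pcomm y x * w := by
    rw [← aux_inv x y]; group
  rw [e, aux_inv, key, key, aux_mul _ _ _ (L _ _ _), aux_mul] at h
  · exact h
  · rw [← aux_inv w z]; exact (L _ _ _).inv_left

theorem aux_sq {G : Type*} [Group G]
    (L : ∀ x y z : G, Commute (pcomm x y) (pcomm x z)) (w x y z : G) :
    (pcomm (pcomm w x) (pcomm y z)) ^ 2 = 1 := by
  have h : pcomm (pcomm w x) (pcomm y z) = (pcomm (pcomm w x) (pcomm y z))⁻¹ := by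
    rw [aux_inv, ← aux_cyc L x y z w, ← aux_cyc L]
  rw [sq]; nth_rw 1 [h]; exact inv_mul_cancel _

theorem aux_swap {G : Type*} [Group G]
    (L : ∀ x y z : G, Commute (pcomm x y) (pcomm x z)) (a b c d : G) :
    pcomm (pcomm a b) (pcomm c d) = pcomm (pcomm b a) (pcomm c d) := by
  have com : Commute (pcomm a b) (pcomm (pcomm a b) (pcomm c d)) := by
    rw [← aux_cyc L b c d a]
    have h1 : Commute (pcomm a b) (pcomm b c) := by
      rw [← aux_inv b a]; exact (L _ _ _).inv_left
    have h2 : Commute (pcomm a b) (pcomm d a) := by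
      rw [← aux_inv a d]; exact (L _ _ _).inv_right
    have e : ∀ p q : G, pcomm p q = p⁻¹ * q⁻¹ * p * q := fun _ _ => rfl
    rw [e (pcomm b c)]
    exact ((h1.inv_right.mul_right h2.inv_right).mul_right h1).mul_right h2
  have hsq := aux_sq L a b c d
  have inv : (pcomm (pcomm a b) (pcomm c d))⁻¹ = pcomm (pcomm a b) (pcomm c d) := by
    exact inv_eq_of_mul_eq_one_left (by rw [← sq]; exact hsq)
  rw [← aux_inv a b]
  generalize pcomm a b = u at *
  generalize pcomm c d = v at *
  calc pcomm u v = u * pcomm u v * u⁻¹ := by rw [com.eq]; group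
    _ = u * (pcomm u v)⁻¹ * u⁻¹ := by rw [inv]
    _ = _ := by unfold pcomm; group

theorem stmt_9 {G : Type*} [Group G] :
    ((∀ w x y z : G, cbull (cstar w x) (cstar y z) = cstar (cbull w y) (cbull x z)) ∧
     (cstar : G → G → G) ≠ cbull) ↔
    ((∀ x y z : G, pcomm (pcomm x y) (pcomm x z) = 1) ∧
     (∀ w x y z : G, (pcomm (pcomm w x) (pcomm y z)) ^ 2 = 1) ∧
     (∃ x y : G, (pcomm x y) ^ 2 ≠ 1)) := by
  have hp : ∀ x y : G, pcomm x y = pcomm y x ↔ (pcomm x y) ^ 2 = 1 := by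
    intro x y
    rw [← aux_inv x y, sq, eq_inv_iff_mul_eq_one]
  have hne : ((cstar : G → G → G) ≠ cbull) ↔ ∃ x y : G, (pcomm x y) ^ 2 ≠ 1 := by
    simp only [ne_eq, funext_iff, not_forall, cstar, cbull, hp]
  rw [hne, ← and_assoc]
  refine and_congr_left fun _ => ?_
  simp only [cstar, cbull]
  constructor
  · intro I
    have L : ∀ x y z : G, pcomm (pcomm x y) (pcomm x z) = 1 := by
      intro x y z
      rw [← I y z x x]
      unfold pcomm; group
    exact ⟨L, aux_sq fun x y z => (aux_comm _ _).1 (L x y z)⟩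
  · rintro ⟨L', -⟩ w x y z
    have L : ∀ x y z : G, Commute (pcomm x y) (pcomm x z) :=
      fun x y z => (aux_comm _ _).1 (L' x y z)
    rw [aux_cyc L y z w x, aux_cyc L x y z w, aux_cyc L w x y z, aux_swap L z w x y,
      aux_cyc L w z x y]
end

section
/- Let G be a group with operations x * y = [x,y] and x • y = [y,x]. Then (G, *, •) is a proper double semigroup (i.e., the interchange law (w * x) • (y * z) = (w • y) * (x • z) holds for all w, x, y, z ∈ G, both operations are associative, and the two operations are distinct) if and only if [[x,y],z] = 1 for all x, y, z ∈ G and there exist x, y ∈ G with [x,y]² ≠ 1. -/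
theorem pc_swap {G : Type*} [Group G] (x y : G) : pcomm y x = (pcomm x y)⁻¹ := by
  simp [pcomm, mul_assoc]

theorem pc_eq_one {G : Type*} [Group G] {x y : G} : pcomm x y = 1 ↔ Commute x y := by
  have h : pcomm x y = (y * x)⁻¹ * (x * y) := by simp [pcomm, mul_assoc]
  rw [h, inv_mul_eq_one]
  exact eq_comm

theorem pc_inv_right {G : Type*} [Group G] {x y : G} (h : Commute y (pcomm x y)) :
    pcomm x y⁻¹ = (pcomm x y)⁻¹ := by
  have h1 : pcomm x y⁻¹ = y * (pcomm x y)⁻¹ * y⁻¹ := by simp [pcomm, mul_assoc]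
  rw [h1, h.inv_right.eq, mul_inv_cancel_right]

theorem pc_inv_left {G : Type*} [Group G] {x y : G} (h : Commute x (pcomm x y)) :
    pcomm x⁻¹ y = (pcomm x y)⁻¹ := by
  have h1 : pcomm x⁻¹ y = x * (pcomm x y)⁻¹ * x⁻¹ := by simp [pcomm, mul_assoc]
  rw [h1, h.inv_right.eq, mul_inv_cancel_right]

theorem pc_hall_witt {G : Type*} [Group G] (x y z : G) :
    (y⁻¹ * pcomm (pcomm x y⁻¹) z * y) * (z⁻¹ * pcomm (pcomm y z⁻¹) x * z) *
      (x⁻¹ * pcomm (pcomm z x⁻¹) y * x) = 1 := by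
  simp [pcomm, mul_assoc]

theorem pc_class_two {G : Type*} [Group G]
    (hA : ∀ x y z : G, pcomm (pcomm x y) z = pcomm x (pcomm y z)) (x y z : G) :
    pcomm (pcomm x y) z = 1 := by
  have cl : ∀ x y : G, Commute x (pcomm x y) := fun x y => by
    rw [← pc_eq_one, ← hA]; simp [pcomm]
  have cr : ∀ x y : G, Commute y (pcomm x y) := fun x y => by
    refine Commute.symm ?_
    rw [← pc_eq_one, hA]; simp [pcomm]
  have s12 : ∀ x y z : G, pcomm (pcomm y x) z = (pcomm (pcomm x y) z)⁻¹ := fun x y z => by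
    rw [pc_swap x y, pc_inv_left (cl _ _)]
  have s23 : ∀ x y z : G, pcomm (pcomm x z) y = (pcomm (pcomm x y) z)⁻¹ := fun x y z => by
    rw [hA x y z, hA x z y, pc_swap y z, pc_inv_right (cr _ _)]
  have rot : ∀ x y z : G, pcomm (pcomm y z) x = pcomm (pcomm x y) z := fun x y z => by
    rw [s23 y x z, s12 x y z, inv_inv]
  have rot' : ∀ x y z : G, pcomm (pcomm y z) x = (pcomm (pcomm x y) z)⁻¹ := fun x y z => by
    rw [hA x y z, pc_swap]
  have sq : pcomm (pcomm x y) z = (pcomm (pcomm x y) z)⁻¹ := by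
    exact (rot x y z).symm.trans (rot' x y z)
  have key : ∀ x y z : G, y⁻¹ * pcomm (pcomm x y⁻¹) z * y = (pcomm (pcomm x y) z)⁻¹ := by
    intro x y z
    rw [pc_inv_right (cr x y), pc_inv_left (cl _ _)]
    have h : Commute y (pcomm (pcomm x y) z) := by
      rw [← rot x y z, ← rot y z x]; exact cr _ _
    rw [mul_assoc, ← h.inv_right.eq, inv_mul_cancel_left]
  have hw := pc_hall_witt x y z
  rw [key, key, key, rot y z x, rot x y z, ← sq] at hw
  have h2 : pcomm (pcomm x y) z * pcomm (pcomm x y) z = 1 := by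
    nth_rewrite 1 [sq]; simp
  rwa [h2, one_mul] at hw

theorem stmt_11 {G : Type*} [Group G] :
    ((∀ w x y z : G, cbull (cstar w x) (cstar y z) = cstar (cbull w y) (cbull x z)) ∧
     (∀ x y z : G, cstar (cstar x y) z = cstar x (cstar y z)) ∧
     (∀ x y z : G, cbull (cbull x y) z = cbull x (cbull y z)) ∧
     (cstar : G → G → G) ≠ cbull) ↔
    ((∀ x y z : G, pcomm (pcomm x y) z = 1) ∧ (∃ x y : G, (pcomm x y) ^ 2 ≠ 1)) := by
  constructor
  · rintro ⟨-, hA, -, hne⟩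
    refine ⟨pc_class_two hA, ?_⟩
    by_contra! hc
    apply hne
    funext x y
    have h := hc x y
    rw [sq, mul_eq_one_iff_eq_inv, ← pc_swap] at h
    exact h
  · rintro ⟨h, x, y, hxy⟩
    have h' : ∀ x y z : G, pcomm x (pcomm y z) = 1 := fun x y z => by
      rw [pc_swap, h, inv_one]
    refine ⟨?_, ?_, ?_, ?_⟩
    · intro w x y z
      simp only [cbull, cstar, h]
    · intro x y z
      simp only [cstar, h, h']
    · intro x y z
      simp only [cbull, h, h']
    · intro he
      apply hxy
      have h1 : pcomm x y = pcomm y x := congrFun (congrFun he x) y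
      rw [sq, mul_eq_one_iff_eq_inv, ← pc_swap]
      exact h1
end
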